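/- Let I be a uniformly Fréchet convergence ideal on B with choice functions F_k. Define V_n = {a : a ≤ F_n(x⃗) for some x⃗ ∈ I}, U_n = V_1 ∩ ... ∩ V_n, C_n = B \ U_n. Then {C_n} is a fragmentation of B: the C_n are increasing, upward closed, and their union is B \ {0}. -/

import Mathlib

open Filter Topology

variable {α : Type*}

/-- A convergence ideal on a Boolean algebra: a set of infinite sequences
(i) with no nonzero common lower bound, (ii) closed under subsequences,
(iii) closed under minorization, (iv) closed under pairwise joins, and
(v) containing every infinite antichain (sequence of pairwise disjoint nonzero elements). -/
def IsConvIdeal [BooleanAlgebra α] (I : Set (ℕ → α)) : Prop :=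
  (∀ a ∈ I, ∀ b : α, (∀ n, b ≤ a n) → b = ⊥) ∧
  (∀ a ∈ I, ∀ φ : ℕ → ℕ, StrictMono φ → (fun n => a (φ n)) ∈ I) ∧
  (∀ a ∈ I, ∀ b : ℕ → α, (∀ n, b n ≤ a n) → b ∈ I) ∧
  (∀ a ∈ I, ∀ b ∈ I, (fun n => a n ⊔ b n) ∈ I) ∧
  (∀ a : ℕ → α, (∀ n, a n ≠ ⊥) → (∀ i j, i ≠ j → a i ⊓ a j = ⊥) → a ∈ I)

/-- `ConvTo I a c` : the sequence `a` converges to `c`, i.e. `{a n ∆ c} ∈ I`. -/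
def ConvTo [BooleanAlgebra α] (I : Set (ℕ → α)) (a : ℕ → α) (c : α) : Prop :=
  (fun n => symmDiff (a n) c) ∈ I

/-- `F k` picks a term of its argument sequence. -/
def IsSelective [BooleanAlgebra α] (F : ℕ → (ℕ → α) → α) : Prop :=
  ∀ k, ∀ x : ℕ → α, ∃ n, F k x = x n

/-- Uniform Fréchet property of a convergence ideal witnessed by choice functions `F`. -/
def UnifFrechet [BooleanAlgebra α] (I : Set (ℕ → α)) (F : ℕ → (ℕ → α) → α) : Prop :=
  ∀ x : ℕ → ℕ → α, (∀ k, x k ∈ I) → (fun k => F k (x k)) ∈ I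

/-- A fragmentation: an increasing chain of upward closed sets with union `B \\ {0}`. -/
def IsFragmentation [BooleanAlgebra α] (C : ℕ → Set α) : Prop :=
  Monotone C ∧ (∀ n, ∀ a ∈ C n, ∀ b, a ≤ b → b ∈ C n) ∧ (⋃ n, C n) = {a : α | a ≠ ⊥}

/-- `Vset I F k = {a : a ≤ F k x for some x ∈ I}`. -/
def Vset [BooleanAlgebra α] (I : Set (ℕ → α)) (F : ℕ → (ℕ → α) → α) (k : ℕ) : Set α :=
  {a | ∃ x ∈ I, a ≤ F k x}

/-- `Uset I F n = Vset 0 ∩ ... ∩ Vset n`. -/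
def Uset [BooleanAlgebra α] (I : Set (ℕ → α)) (F : ℕ → (ℕ → α) → α) (n : ℕ) : Set α :=
  {a | ∀ k ≤ n, a ∈ Vset I F k}

/-- `Cset I F n = B \\ Uset I F n`. -/
def Cset [BooleanAlgebra α] (I : Set (ℕ → α)) (F : ℕ → (ℕ → α) → α) (n : ℕ) : Set α :=
  (Uset I F n)ᶜ

/-- A nontrivial atomless Boolean algebra has an infinite antichain. -/
theorem exists_infinite_antichain [BooleanAlgebra α] (hnt : (⊥ : α) ≠ ⊤)
    (hatomless : ∀ a : α, a ≠ ⊥ → ∃ b, b ≠ ⊥ ∧ b < a) :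
    ∃ a : ℕ → α, (∀ n, a n ≠ ⊥) ∧ ∀ i j, i ≠ j → a i ⊓ a j = ⊥ := by
  choose f hf hlt using hatomless
  let s : ℕ → {a : α // a ≠ ⊥} := fun n =>
    Nat.rec ⟨⊤, hnt.symm⟩ (fun _ a => ⟨f a.1 a.2, hf a.1 a.2⟩) n
  have hs : ∀ n, (s (n + 1)).1 < (s n).1 := fun n => hlt (s n).1 (s n).2
  have hanti : Antitone fun n => (s n).1 := antitone_nat_of_succ_le fun n => (hs n).le
  have hdisj : ∀ i j, i < j →
      Disjoint ((s i).1 \ (s (i + 1)).1) ((s j).1 \ (s (j + 1)).1) := fun i j hij =>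
    disjoint_sdiff_self_left.mono_right (sdiff_le.trans (hanti (Nat.succ_le_of_lt hij)))
  refine ⟨fun n => (s n).1 \ (s (n + 1)).1, fun n h => ?_, fun i j hij => ?_⟩
  · exact (hs n).not_ge (sdiff_eq_bot_iff.mp h)
  · rcases lt_or_gt_of_ne hij with h | h
    · exact (hdisj i j h).eq_bot
    · exact (hdisj j i h).symm.eq_bot

theorem stmt10 [BooleanAlgebra α] (hnt : (⊥ : α) ≠ ⊤) (hatomless : ∀ a : α, a ≠ ⊥ → ∃ b, b ≠ ⊥ ∧ b < a)
    (I : Set (ℕ → α)) (hI : IsConvIdeal I)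
    (F : ℕ → (ℕ → α) → α) (hsel : IsSelective F) (hunif : UnifFrechet I F) :
    IsFragmentation (Cset I F) := by
  refine ⟨fun m n hmn a ha hU => ha fun k hk => hU k (hk.trans hmn), fun n a ha b hab hU => ?_, ?_⟩
  · refine ha fun k hk => ?_
    obtain ⟨x, hx, hb⟩ := hU k hk
    exact ⟨x, hx, hab.trans hb⟩
  · ext a
    rw [Set.mem_iUnion, Set.mem_ofPred_eq]
    constructor
    · rintro ⟨n, hn⟩ rfl
      obtain ⟨x, hne, hdisj⟩ := exists_infinite_antichain hnt hatomless
      exact hn fun k _ => ⟨x, hI.2.2.2.2 x hne hdisj, bot_le⟩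
    · intro ha
      by_contra! h
      have hV : ∀ k, a ∈ Vset I F k := fun k => Set.not_notMem.mp (h k) k le_rfl
      choose x hx hle using hV
      exact ha (hI.1 _ (hunif x hx) a hle)
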